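/- Let f : ℝ^n → ℝ be convex, differentiable, and locally smooth, with a minimizer x* and optimal value f*. Let (x_k) be generated by x_{k+1} = x_k − α_k ∇f(x_k) with ∇f(x_k) ≠ 0 for all k, and suppose that for all k ≥ 0 (given α_{−1} > 0 and γ̃_{−1} ∈ (0,1)) the stepsizes only satisfy the two inequality constraints α_k·L_k ≤ γ̃_k and α_k ≤ (α_{k−1}/γ̃_k²)·(1 − γ̃_k²)/(1 − γ̃_{k−1}²), where γ̃_k ∈ (0,1) and L_k := ‖∇f(x_{k+1}) − ∇f(x_k)‖/‖x_{k+1} − x_k‖. Then the function Ṽ_k := ‖x_k − x*‖² + (2 α_{k−1}/(1 − γ̃_{k−1}²))·(f(x_k) − f*) is nonincreasing in k, and for every k ≥ 2, f(x_k) − f* ≤ (‖x_0 − x*‖² + 2 α_0·(γ̃_0²/(1 − γ̃_0²))·(f(x_0) − f*)) / (2·Σ_{i=1}^{k−1} α_i). (This captures robustness of AFFGD to inexact gradient information: bounds of the form α_k ≤ γ_k/(a_k L_k) with a_k ∈ (γ_k,1) satisfy the hypotheses with γ̃_k = γ_k/a_k.) -/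

import Mathlib

open scoped RealInnerProductSpace

/-- First-order characterization: a convex function lies above its tangent planes. -/
theorem ConvexOn.add_inner_gradient_le {E : Type*} [NormedAddCommGroup E]
    [InnerProductSpace ℝ E] [CompleteSpace E] {f : E → ℝ} (hf : ConvexOn ℝ Set.univ f)
    {u g : E} (hg : HasGradientAt f g u) (v : E) : f u + ⟪g, v - u⟫ ≤ f v := by
  have hφ : ConvexOn ℝ Set.univ (fun t : ℝ => f (AffineMap.lineMap u v t)) := by
    simpa using! hf.comp_affineMap (AffineMap.lineMap u v)
  have hline : HasDerivAt (fun t : ℝ => AffineMap.lineMap u v t) (v - u) (0 : ℝ) :=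
    AffineMap.hasDerivAt_lineMap
  have hderiv : HasDerivAt (fun t : ℝ => f (AffineMap.lineMap u v t)) ⟪g, v - u⟫ 0 := by
    have hF : HasFDerivAt f (InnerProductSpace.toDual ℝ E g) (AffineMap.lineMap u v (0 : ℝ)) := by
      simpa using hg.hasFDerivAt
    simpa using! hF.comp_hasDerivAt (0 : ℝ) hline
  have h := hφ.le_slope_of_hasDerivAt (Set.mem_univ 0) (Set.mem_univ 1) one_pos hderiv
  simp [slope_def_field] at h
  linarith

/-- If the gradient varies by at most the fraction `r` of its norm along a gradient step of
length `a`, that step decreases a convex function by at least `a (1 - r²) ‖g‖² / 2`. -/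
theorem ConvexOn.gradient_step_decrease {E : Type*} [NormedAddCommGroup E]
    [InnerProductSpace ℝ E] [CompleteSpace E] {f : E → ℝ} (hf : ConvexOn ℝ Set.univ f)
    {u g g₁ : E} {a r : ℝ} (ha : 0 ≤ a) (hg₁ : HasGradientAt f g₁ (u - a • g))
    (hr : ‖g₁ - g‖ ≤ r * ‖g‖) :
    f (u - a • g) + a * (1 - r ^ 2) * ‖g‖ ^ 2 / 2 ≤ f u := by
  have h := hf.add_inner_gradient_le hg₁ u
  rw [sub_sub_cancel, real_inner_smul_right] at h
  have hsq : ‖g₁ - g‖ ^ 2 ≤ (r * ‖g‖) ^ 2 := pow_le_pow_left₀ (norm_nonneg _) hr 2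
  rw [norm_sub_sq_real] at hsq
  nlinarith [mul_le_mul_of_nonneg_left hsq ha, mul_nonneg ha (sq_nonneg ‖g₁‖)]

/-- One-step energy estimate of gradient descent on a convex function. -/
theorem ConvexOn.gradient_step_energy {E : Type*} [NormedAddCommGroup E]
    [InnerProductSpace ℝ E] [CompleteSpace E] {f : E → ℝ} (hf : ConvexOn ℝ Set.univ f)
    {u g z : E} {a r d : ℝ} (ha : 0 ≤ a) (hr : r ^ 2 < 1) (hg : HasGradientAt f g u)
    (hd : f (u - a • g) + a * (1 - r ^ 2) * ‖g‖ ^ 2 / 2 ≤ f u)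
    (hc : d = 2 * a / (1 - r ^ 2)) :
    ‖u - a • g - z‖ ^ 2 + d * (f (u - a • g) - f z) ≤
      ‖u - z‖ ^ 2 + d * r ^ 2 * (f u - f z) := by
  have h := hf.add_inner_gradient_le hg z
  have hpos : 0 < 1 - r ^ 2 := by linarith
  have hd0 : 0 ≤ d := hc ▸ by positivity
  have hda : d * (1 - r ^ 2) = 2 * a := by rw [hc]; field_simp
  have hexp : ‖u - a • g - z‖ ^ 2 = ‖u - z‖ ^ 2 + 2 * a * ⟪g, z - u⟫ + a ^ 2 * ‖g‖ ^ 2 := by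
    rw [sub_right_comm, norm_sub_sq_real, real_inner_smul_right, norm_smul, mul_pow,
      Real.norm_eq_abs, sq_abs, ← neg_sub z u, inner_neg_left, real_inner_comm]
    ring
  rw [hexp]
  have h₁ := mul_le_mul_of_nonneg_left hd hd0
  have h₂ := mul_le_mul_of_nonneg_left h ha
  have h₃ : d * (a * (1 - r ^ 2) * ‖g‖ ^ 2 / 2) = a ^ 2 * ‖g‖ ^ 2 := by
    linear_combination (a * ‖g‖ ^ 2 / 2) * hda
  have h₄ : d * r ^ 2 * (f u - f z) = d * (f u - f z) - 2 * a * (f u - f z) := by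
    linear_combination -(f u - f z) * hda
  rw [h₄]
  linarith

/-- Robustness of AFFGD to inexact gradient information: if the (positive) stepsizes only
satisfy the two inequality constraints `α_k L_k ≤ γ̃_k` and
`α_k ≤ (α_{k-1}/γ̃_k²)(1-γ̃_k²)/(1-γ̃_{k-1}²)` with `γ̃_k ∈ (0,1)`, then
`Ṽ_k = ‖x_k - x*‖² + (2α_{k-1}/(1-γ̃_{k-1}²))(f(x_k) - f*)` is nonincreasing and the
last-iterate rate `F_k ≤ (‖x_0 - x*‖² + 2α_0(γ̃_0²/(1-γ̃_0²))F_0)/(2Σ_{i=1}^{k-1} α_i)`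
holds for `k ≥ 2`. Indexing convention: the paper's `α_{k-1}, γ̃_{k-1}` (including
`α_{-1}, γ̃_{-1}`) are `α k, γ k` here, so the paper's `α_k, γ̃_k` are `α (k+1), γ (k+1)`
and the paper's `α_0, γ̃_0` are `α 1, γ 1`. -/
theorem affgd_robust_inexact
    {n : ℕ} (f : EuclideanSpace ℝ (Fin n) → ℝ)
    (f' : EuclideanSpace ℝ (Fin n) → EuclideanSpace ℝ (Fin n))
    (hdiff : ∀ z, HasGradientAt f (f' z) z)
    (hconv : ConvexOn ℝ Set.univ f)
    (hloc : ∀ D : Set (EuclideanSpace ℝ (Fin n)), Convex ℝ D → IsCompact D →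
      ∃ L > (0 : ℝ), ∀ u ∈ D, ∀ v ∈ D, ‖f' v - f' u‖ ≤ L * ‖v - u‖)
    (xs : EuclideanSpace ℝ (Fin n)) (hmin : ∀ z, f xs ≤ f z)
    (x : ℕ → EuclideanSpace ℝ (Fin n)) (α γ : ℕ → ℝ)
    (hγ : ∀ k, γ k ∈ Set.Ioo (0 : ℝ) 1)
    (hαpos : ∀ k, 0 < α k)
    (hgrad : ∀ k, f' (x k) ≠ 0)
    (hstep : ∀ k, x (k + 1) = x k - α (k + 1) • f' (x k))
    (hα1 : ∀ k, α (k + 1) * (‖f' (x (k + 1)) - f' (x k)‖ / ‖x (k + 1) - x k‖) ≤ γ (k + 1))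
    (hα2 : ∀ k, α (k + 1) ≤
      (α k / γ (k + 1) ^ 2) * ((1 - γ (k + 1) ^ 2) / (1 - γ k ^ 2))) :
    Antitone (fun k : ℕ =>
        ‖x k - xs‖ ^ 2 + (2 * α k / (1 - γ k ^ 2)) * (f (x k) - f xs)) ∧
    ∀ k : ℕ, 2 ≤ k →
      f (x k) - f xs ≤
        (‖x 0 - xs‖ ^ 2 + 2 * α 1 * (γ 1 ^ 2 / (1 - γ 1 ^ 2)) * (f (x 0) - f xs)) /
          (2 * ∑ i ∈ Finset.Ico 1 k, α (i + 1)) := by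
  have hone (k : ℕ) : γ k ^ 2 < 1 := by nlinarith [(hγ k).1, (hγ k).2]
  have hsub (k : ℕ) : 0 < 1 - γ k ^ 2 := sub_pos.2 (hone k)
  have hF (k : ℕ) : 0 ≤ f (x k) - f xs := sub_nonneg.2 (hmin _)
  obtain ⟨c, hc⟩ : ∃ c : ℕ → ℝ, ∀ k, c k = 2 * α k / (1 - γ k ^ 2) := ⟨_, fun _ => rfl⟩
  have hcpos (k : ℕ) : 0 < c k := by
    rw [hc]
    exact div_pos (mul_pos two_pos (hαpos k)) (hsub k)
  have hcγ (k : ℕ) : c (k + 1) * γ (k + 1) ^ 2 ≤ c k := by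
    have h₀ := hsub k
    have h₁ := hsub (k + 1)
    have hγpos := (hγ (k + 1)).1
    calc c (k + 1) * γ (k + 1) ^ 2
        = 2 * γ (k + 1) ^ 2 / (1 - γ (k + 1) ^ 2) * α (k + 1) := by rw [hc]; ring
      _ ≤ 2 * γ (k + 1) ^ 2 / (1 - γ (k + 1) ^ 2) *
          ((α k / γ (k + 1) ^ 2) * ((1 - γ (k + 1) ^ 2) / (1 - γ k ^ 2))) := by
        gcongr
        exact hα2 k
      _ = c k := by rw [hc]; field_simp
  have hvar (k : ℕ) : ‖f' (x (k + 1)) - f' (x k)‖ ≤ γ (k + 1) * ‖f' (x k)‖ := by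
    have h := hα1 k
    have hα := hαpos (k + 1)
    have hg := norm_pos_iff.2 (hgrad k)
    have hnorm : ‖x (k + 1) - x k‖ = α (k + 1) * ‖f' (x k)‖ := by
      rw [hstep, sub_sub_cancel_left, norm_neg, norm_smul, Real.norm_of_nonneg hα.le]
    rwa [hnorm, ← mul_div_assoc, mul_div_mul_left _ _ hα.ne', div_le_iff₀ hg] at h
  have hdec (k : ℕ) :
      f (x (k + 1)) + α (k + 1) * (1 - γ (k + 1) ^ 2) * ‖f' (x k)‖ ^ 2 / 2 ≤ f (x k) := by
    have h := hconv.gradient_step_decrease (u := x k) (hαpos (k + 1)).le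
      (by rw [← hstep]; exact hdiff _) (hvar k)
    rwa [← hstep] at h
  have hmono (k : ℕ) : f (x (k + 1)) ≤ f (x k) := by
    have := mul_nonneg (mul_pos (hαpos (k + 1)) (hsub (k + 1))).le (sq_nonneg ‖f' (x k)‖)
    linarith [hdec k]
  have henergy (k : ℕ) :
      ‖x (k + 1) - xs‖ ^ 2 + c (k + 1) * (f (x (k + 1)) - f xs) ≤
        ‖x k - xs‖ ^ 2 + c (k + 1) * γ (k + 1) ^ 2 * (f (x k) - f xs) := by
    have h := hconv.gradient_step_energy (z := xs) (hαpos (k + 1)).le (hone (k + 1))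
      (hdiff (x k)) (hstep k ▸ hdec k) (hc (k + 1))
    rwa [← hstep] at h
  refine ⟨antitone_nat_of_succ_le fun k => ?_, fun k hk => ?_⟩
  · simp only [← hc]
    linarith [henergy k, mul_le_mul_of_nonneg_right (hcγ k) (hF k)]
  have hsum (m : ℕ) : c (m + 1) ≤ c 1 + 2 * ∑ i ∈ Finset.Ico 1 (m + 1), α (i + 1) ∧
      ‖x (m + 1) - xs‖ ^ 2 + (c 1 + 2 * ∑ i ∈ Finset.Ico 1 (m + 1), α (i + 1)) *
        (f (x (m + 1)) - f xs) ≤ ‖x 0 - xs‖ ^ 2 + c 1 * γ 1 ^ 2 * (f (x 0) - f xs) := by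
    induction m with
    | zero => simpa using henergy 0
    | succ m ih =>
      obtain ⟨ihc, ihe⟩ := ih
      rw [Finset.sum_Ico_succ_top (by omega)]
      generalize ∑ i ∈ Finset.Ico 1 (m + 1), α (i + 1) = S at *
      have hα : c (m + 1 + 1) * (1 - γ (m + 1 + 1) ^ 2) = 2 * α (m + 1 + 1) := by
        rw [hc, div_mul_cancel₀ _ (hsub _).ne']
      have hW := sub_nonneg.2 ((hcγ (m + 1)).trans ihc)
      refine ⟨by linarith, ?_⟩
      have hle : (c 1 + 2 * S - c (m + 1 + 1) * γ (m + 1 + 1) ^ 2) * (f (x (m + 1 + 1)) - f xs) ≤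
          (c 1 + 2 * S - c (m + 1 + 1) * γ (m + 1 + 1) ^ 2) * (f (x (m + 1)) - f xs) :=
        mul_le_mul_of_nonneg_left (sub_le_sub_right (hmono (m + 1)) _) hW
      have hsplit : c 1 + 2 * (S + α (m + 1 + 1)) =
          (c 1 + 2 * S - c (m + 1 + 1) * γ (m + 1 + 1) ^ 2) + c (m + 1 + 1) := by
        linear_combination -hα
      rw [hsplit]
      linarith [henergy (m + 1)]
  obtain ⟨m, rfl⟩ : ∃ m, k = m + 1 := ⟨k - 1, by omega⟩
  have hS : 0 < ∑ i ∈ Finset.Ico 1 (m + 1), α (i + 1) :=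
    Finset.sum_pos (fun i _ => hαpos _) (Finset.nonempty_Ico.2 (by omega))
  have hnum : 2 * α 1 * (γ 1 ^ 2 / (1 - γ 1 ^ 2)) = c 1 * γ 1 ^ 2 := by rw [hc]; ring
  rw [le_div_iff₀ (mul_pos two_pos hS), hnum]
  nlinarith [(hsum m).2, sq_nonneg ‖x (m + 1) - xs‖, mul_nonneg (hcpos 1).le (hF (m + 1))]
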